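/- Let Ω ⊂⊂ ℂⁿ be a bounded pseudoconvex domain with C^k (k ≥ 3)-smooth boundary, and let ρ̃ = ρ e^ψ and ρ be two C^k defining functions of Ω, where ψ is a C^{k−1} real-valued function. Let α̃ = α_{ρ̃} and α = α_ρ be the corresponding D'Angelo 1-forms. Then: (i) η_{ρ̃} = e^ψ η_ρ and T_{ρ̃} = e^{−ψ} T_ρ on ∂Ω; (ii) α̃(X) = α(X) + dψ(X) for every X ∈ T^{1,0}(∂Ω) (hence also for X ∈ T^{0,1}(∂Ω)); and (iii) for every p ∈ ∂Ω and L ∈ Null_p, i d^c α̃ (L, L̄) = i d^c α (L, L̄) − i dd^c ψ (L, L̄). -/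

import Mathlib

open Complex
open scoped ComplexOrder

noncomputable section

/-- Points of ℂⁿ. -/
abbrev Pt (n : ℕ) := Fin n → ℂ

/-- Wirtinger derivative ∂f/∂z_j at z (junk value if f is not differentiable). -/
def dZ (n : ℕ) (f : Pt n → ℂ) (j : Fin n) (z : Pt n) : ℂ :=
  (1 / 2 : ℂ) * (fderiv ℝ f z (Pi.single j 1) - Complex.I * fderiv ℝ f z (Pi.single j Complex.I))

/-- Wirtinger derivative ∂f/∂z̄_j at z. -/
def dZb (n : ℕ) (f : Pt n → ℂ) (j : Fin n) (z : Pt n) : ℂ :=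
  (1 / 2 : ℂ) * (fderiv ℝ f z (Pi.single j 1) + Complex.I * fderiv ℝ f z (Pi.single j Complex.I))

/-- Complexification of a real-valued function. -/
def cR (n : ℕ) (ρ : Pt n → ℝ) : Pt n → ℂ := fun z => (ρ z : ℂ)

/-- Levi form of ρ at z: Levi_ρ(X,Y) = Σ_{j,k} ∂²ρ/∂z_j∂z̄_k X_j conj(Y_k), where X, Y are
(1,0)-vectors given by their coefficient tuples. -/
def levi (n : ℕ) (ρ : Pt n → ℝ) (z : Pt n) (X Y : Fin n → ℂ) : ℂ :=
  ∑ j, ∑ k, dZ n (fun w => dZb n (cR n ρ) k w) j z * X j * (starRingEnd ℂ) (Y k)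

/-- Holomorphic tangent space T^{1,0}_p(∂Ω) (for boundary points p), described via a defining
function: (1,0)-vectors X with Σ_j X_j ∂ρ/∂z_j(p) = 0. -/
def T10 (n : ℕ) (ρ : Pt n → ℝ) (p : Pt n) : Set (Fin n → ℂ) :=
  {X | ∑ j, X j * dZ n (cR n ρ) j p = 0}

/-- Null space of the Levi form inside T^{1,0}_p(∂Ω). -/
def nullSp (n : ℕ) (ρ : Pt n → ℝ) (p : Pt n) : Set (Fin n → ℂ) :=
  {X | X ∈ T10 n ρ p ∧ ∀ Y ∈ T10 n ρ p, levi n ρ p X Y = 0}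

/-- ρ is a C^s defining function of Ω on the neighborhood V of the closure of Ω. -/
def IsDefining (n : ℕ) (s : ℕ∞) (Ω : Set (Pt n)) (ρ : Pt n → ℝ) (V : Set (Pt n)) : Prop :=
  IsOpen V ∧ closure Ω ⊆ V ∧ ContDiffOn ℝ s ρ V ∧
    Ω = {z | z ∈ V ∧ ρ z < 0} ∧ ∀ z ∈ frontier Ω, fderiv ℝ ρ z ≠ 0

/-- Strict plurisubharmonicity on a set, via positivity of the Levi form. -/
def StrictPSHOn (n : ℕ) (f : Pt n → ℝ) (s : Set (Pt n)) : Prop :=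
  ∀ z ∈ s, ∀ X : Fin n → ℂ, X ≠ 0 → 0 < (levi n f z X X).re

/-- Diederich–Fornaess exponent of a defining function ρ (0 if the defining set is empty). -/
def DFexp (n : ℕ) (ρ : Pt n → ℝ) (Ω : Set (Pt n)) : ℝ :=
  sSup {η : ℝ | 0 < η ∧ η < 1 ∧ StrictPSHOn n (fun z => -((-ρ z) ^ η)) Ω}

/-- Diederich–Fornaess index of Ω: supremum over all (C¹) defining functions. -/
def DFindex (n : ℕ) (Ω : Set (Pt n)) : ℝ :=
  sSup {e : ℝ | ∃ ρ V, IsDefining n 1 Ω ρ V ∧ e = DFexp n ρ Ω}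

/-- Steinness exponent of a defining function ρ (⊤ = ∞ if the defining set is empty). -/
def Sexp (n : ℕ) (ρ : Pt n → ℝ) (Ω : Set (Pt n)) : EReal :=
  sInf {e : EReal | ∃ η : ℝ, 1 < η ∧
    (∃ U : Set (Pt n), IsOpen U ∧ frontier Ω ⊆ U ∧
      StrictPSHOn n (fun z => ρ z ^ η) ((closure Ω)ᶜ ∩ U)) ∧ e = (η : EReal)}

/-- Steinness index of Ω: infimum over all (C¹) defining functions. -/
def Sindex (n : ℕ) (Ω : Set (Pt n)) : EReal :=
  sInf {e : EReal | ∃ ρ V, IsDefining n 1 Ω ρ V ∧ e = Sexp n ρ Ω}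

/-- A complex vector field Σ_j a_j ∂/∂z_j + Σ_j b_j ∂/∂z̄_j on ℂⁿ, recorded by its
coefficient functions. -/
structure VF (n : ℕ) where
  a : Pt n → Fin n → ℂ
  b : Pt n → Fin n → ℂ

/-- Action of a complex vector field on a function. -/
def VF.app {n : ℕ} (V : VF n) (f : Pt n → ℂ) (z : Pt n) : ℂ :=
  ∑ j, V.a z j * dZ n f j z + ∑ j, V.b z j * dZb n f j z

/-- The value of a vector field at a point, as a pair ((1,0)-part, (0,1)-part). -/
def VF.atPt {n : ℕ} (V : VF n) (p : Pt n) : (Fin n → ℂ) × (Fin n → ℂ) := (V.a p, V.b p)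

/-- A complex 1-form Σ_j w_j dz_j + Σ_j t_j dz̄_j on ℂⁿ. -/
structure Form1 (n : ℕ) where
  w : Pt n → Fin n → ℂ
  t : Pt n → Fin n → ℂ

/-- Value of a 1-form at a point on a complex tangent vector (pair of (1,0) and (0,1) parts). -/
def Form1.eval {n : ℕ} (η : Form1 n) (z : Pt n) (X : (Fin n → ℂ) × (Fin n → ℂ)) : ℂ :=
  ∑ j, η.w z j * X.1 j + ∑ j, η.t z j * X.2 j

/-- Pairing of a 1-form with a vector field. -/
def Form1.app {n : ℕ} (η : Form1 n) (V : VF n) (z : Pt n) : ℂ :=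
  η.eval z (V.atPt z)

/-- Lie bracket of complex vector fields. -/
def VF.bracket {n : ℕ} (V W : VF n) : VF n :=
  ⟨fun z j => V.app (fun w => W.a w j) z - W.app (fun w => V.a w j) z,
   fun z j => V.app (fun w => W.b w j) z - W.app (fun w => V.b w j) z⟩

/-- Levi-Civita covariant derivative ∇_V W of the Euclidean metric (componentwise derivative). -/
def covD {n : ℕ} (V W : VF n) : VF n :=
  ⟨fun z j => V.app (fun w => W.a w j) z, fun z j => V.app (fun w => W.b w j) z⟩

/-- Lie derivative of a 1-form along a vector field, in coordinates. -/
def lieD {n : ℕ} (T : VF n) (η : Form1 n) : Form1 n :=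
  ⟨fun z j => T.app (fun w => η.w w j) z + ∑ m, η.w z m * dZ n (fun w => T.a w m) j z
      + ∑ m, η.t z m * dZ n (fun w => T.b w m) j z,
   fun z j => T.app (fun w => η.t w j) z + ∑ m, η.w z m * dZb n (fun w => T.a w m) j z
      + ∑ m, η.t z m * dZb n (fun w => T.b w m) j z⟩

/-- Negation of a 1-form. -/
def Form1.neg {n : ℕ} (η : Form1 n) : Form1 n := ⟨fun z j => -η.w z j, fun z j => -η.t z j⟩

/-- Σ_j |∂ρ/∂z_j|². -/
def gradSq (n : ℕ) (ρ : Pt n → ℝ) (z : Pt n) : ℝ :=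
  ∑ j, Complex.normSq (dZ n (cR n ρ) j z)

/-- Norm of the real gradient of ρ: ‖∇ρ‖ = 2 (Σ_j |∂ρ/∂z_j|²)^{1/2}. -/
def gradNorm (n : ℕ) (ρ : Pt n → ℝ) (z : Pt n) : ℝ := 2 * Real.sqrt (gradSq n ρ z)

/-- The (1,0) field L_n = (Σ|∂ρ/∂z_j|²)⁻¹ Σ_j (∂ρ/∂z̄_j) ∂/∂z_j. -/
def LnVF (n : ℕ) (ρ : Pt n → ℝ) : VF n :=
  ⟨fun z j => dZb n (cR n ρ) j z / (gradSq n ρ z : ℂ), fun _ _ => 0⟩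

/-- The (1,0) field N = (Σ|∂ρ/∂z_j|²)^{-1/2} Σ_j (∂ρ/∂z̄_j) ∂/∂z_j. -/
def NVF (n : ℕ) (ρ : Pt n → ℝ) : VF n :=
  ⟨fun z j => dZb n (cR n ρ) j z / ((Real.sqrt (gradSq n ρ z) : ℝ) : ℂ), fun _ _ => 0⟩

/-- T = L_n − conj(L_n). -/
def TVF (n : ℕ) (ρ : Pt n → ℝ) : VF n :=
  ⟨fun z j => (LnVF n ρ).a z j, fun z j => -(starRingEnd ℂ) ((LnVF n ρ).a z j)⟩

/-- η = (1/2)(∂ρ − ∂̄ρ). -/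
def etaF (n : ℕ) (ρ : Pt n → ℝ) : Form1 n :=
  ⟨fun z j => (1 / 2 : ℂ) * dZ n (cR n ρ) j z,
   fun z j => -(1 / 2 : ℂ) * dZb n (cR n ρ) j z⟩

/-- The D'Angelo 1-form α_ρ = −Lie_T η of a defining function ρ. -/
def dAngelo (n : ℕ) (ρ : Pt n → ℝ) : Form1 n := Form1.neg (lieD (TVF n ρ) (etaF n ρ))

/-- Evaluation of the (1,0)-part ∂η of the exterior derivative of a 1-form on two
complex tangent vectors. -/
def delEval {n : ℕ} (η : Form1 n) (X Y : (Fin n → ℂ) × (Fin n → ℂ)) (z : Pt n) : ℂ :=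
  (∑ m, ∑ l, dZ n (fun w => η.w w l) m z * (X.1 m * Y.1 l - Y.1 m * X.1 l)) +
  (∑ m, ∑ l, dZ n (fun w => η.t w l) m z * (X.1 m * Y.2 l - Y.1 m * X.2 l))

/-- Evaluation of ∂̄η of a 1-form η on two complex tangent vectors. -/
def delbEval {n : ℕ} (η : Form1 n) (X Y : (Fin n → ℂ) × (Fin n → ℂ)) (z : Pt n) : ℂ :=
  (∑ m, ∑ l, dZb n (fun w => η.w w l) m z * (X.2 m * Y.1 l - Y.2 m * X.1 l)) +
  (∑ m, ∑ l, dZb n (fun w => η.t w l) m z * (X.2 m * Y.2 l - Y.2 m * X.2 l))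

/-- Evaluation of dη = ∂η + ∂̄η. -/
def dEval {n : ℕ} (η : Form1 n) (X Y : (Fin n → ℂ) × (Fin n → ℂ)) (z : Pt n) : ℂ :=
  delEval η X Y z + delbEval η X Y z

/-- Evaluation of d^c η = i(∂̄ − ∂)η. -/
def dcEval {n : ℕ} (η : Form1 n) (X Y : (Fin n → ℂ) × (Fin n → ℂ)) (z : Pt n) : ℂ :=
  Complex.I * (delbEval η X Y z - delEval η X Y z)

/-- Evaluation of ω ∧ ω̄ on two complex tangent vectors, where ω = π_{1,0} η is the
(1,0)-component of the real 1-form η. -/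
def omegaWedge {n : ℕ} (η : Form1 n) (X Y : (Fin n → ℂ) × (Fin n → ℂ)) (z : Pt n) : ℂ :=
  (∑ j, η.w z j * X.1 j) * (∑ j, (starRingEnd ℂ) (η.w z j) * Y.2 j) -
  (∑ j, η.w z j * Y.1 j) * (∑ j, (starRingEnd ℂ) (η.w z j) * X.2 j)

/-- Evaluation of ∂̄ω where ω = π_{1,0} η. -/
def delbOmega {n : ℕ} (η : Form1 n) (X Y : (Fin n → ℂ) × (Fin n → ℂ)) (z : Pt n) : ℂ :=
  delbEval ⟨η.w, fun _ _ => 0⟩ X Y z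

/-- The standard Euclidean complex Hermitian metric g on complexified tangent vectors
(so that g(∂/∂z_j, ∂/∂z_j) = 1/2). -/
def gMet {n : ℕ} (X Y : (Fin n → ℂ) × (Fin n → ℂ)) : ℂ :=
  (1 / 2 : ℂ) * (∑ j, X.1 j * (starRingEnd ℂ) (Y.1 j) + ∑ j, X.2 j * (starRingEnd ℂ) (Y.2 j))

/-- The real gradient ∇ρ as a complex vector field: 2Σ_j (∂ρ/∂z̄_j ∂/∂z_j + ∂ρ/∂z_j ∂/∂z̄_j). -/
def gradVF (n : ℕ) (ρ : Pt n → ℝ) : VF n :=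
  ⟨fun z j => 2 * dZb n (cR n ρ) j z, fun z j => 2 * dZ n (cR n ρ) j z⟩

/-- Pseudoconvexity of Ω (w.r.t. the defining function ρ): the Levi form is positive
semidefinite on the holomorphic tangent spaces of the boundary. -/
def LeviPseudoconvex (n : ℕ) (ρ : Pt n → ℝ) (Ω : Set (Pt n)) : Prop :=
  ∀ p ∈ frontier Ω, ∀ X ∈ T10 n ρ p, 0 ≤ (levi n ρ p X X).re

/-- The set Σ of weakly pseudoconvex boundary points. -/
def weakPts (n : ℕ) (ρ : Pt n → ℝ) (Ω : Set (Pt n)) : Set (Pt n) :=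
  {p | p ∈ frontier Ω ∧ ∃ X ∈ T10 n ρ p, X ≠ 0 ∧ levi n ρ p X X = 0}

/-- Action of a complex tangent vector at p on a function. -/
def vecApp (n : ℕ) (X : (Fin n → ℂ) × (Fin n → ℂ)) (f : Pt n → ℂ) (p : Pt n) : ℂ :=
  ∑ j, X.1 j * dZ n f j p + ∑ j, X.2 j * dZb n f j p

/-- Pushforward (complexified differential) of a complex tangent vector at p by a map f. -/
def push (n : ℕ) (f : Pt n → Pt n) (p : Pt n) (X : (Fin n → ℂ) × (Fin n → ℂ)) :
    (Fin n → ℂ) × (Fin n → ℂ) :=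
  (fun l => vecApp n X (fun w => f w l) p,
   fun l => vecApp n X (fun w => (starRingEnd ℂ) (f w l)) p)

/-- Conjugation of a coefficient tuple. -/
def conjVec {n : ℕ} (X : Fin n → ℂ) : Fin n → ℂ := fun j => (starRingEnd ℂ) (X j)

/-- A C^k CR-diffeomorphism between ∂Ω₁ and ∂Ω₂, presented by a C^k map f on a
neighborhood U₁ of ∂Ω₁ together with a C^k local inverse g: f maps ∂Ω₁ onto ∂Ω₂
diffeomorphically and its differential maps T^{1,0}(∂Ω₁) into T^{1,0}(∂Ω₂). -/
def IsCRDiffeo (n : ℕ) (k : ℕ∞) (Ω₁ Ω₂ : Set (Pt n)) (ρ₁ ρ₂ : Pt n → ℝ)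
    (f g : Pt n → Pt n) (U₁ U₂ : Set (Pt n)) : Prop :=
  IsOpen U₁ ∧ IsOpen U₂ ∧ frontier Ω₁ ⊆ U₁ ∧ frontier Ω₂ ⊆ U₂ ∧
  (∀ l, ContDiffOn ℝ k (fun z => f z l) U₁) ∧
  (∀ l, ContDiffOn ℝ k (fun z => g z l) U₂) ∧
  f '' frontier Ω₁ = frontier Ω₂ ∧
  (∀ p ∈ frontier Ω₁, g (f p) = p) ∧ (∀ q ∈ frontier Ω₂, f (g q) = q) ∧
  (∀ p ∈ frontier Ω₁, ∀ L ∈ T10 n ρ₁ p,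
    (push n f p (L, 0)).2 = 0 ∧ (push n f p (L, 0)).1 ∈ T10 n ρ₂ (f p))

/-- The 1-form d^c ψ = i(∂̄ψ − ∂ψ) of a real function ψ. -/
def dcForm (n : ℕ) (ψ : Pt n → ℝ) : Form1 n :=
  ⟨fun z j => -Complex.I * dZ n (cR n ψ) j z, fun z j => Complex.I * dZb n (cR n ψ) j z⟩

end

section Wirtinger

variable {n : ℕ} {f g : Pt n → ℂ} {z : Pt n}

theorem dZ_add (hf : DifferentiableAt ℝ f z) (hg : DifferentiableAt ℝ g z) (j : Fin n) :
    dZ n (fun w => f w + g w) j z = dZ n f j z + dZ n g j z := by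
  simp only [dZ, fderiv_fun_add hf hg, add_apply]
  ring

theorem dZb_sub (hf : DifferentiableAt ℝ f z) (hg : DifferentiableAt ℝ g z) (j : Fin n) :
    dZb n (fun w => f w - g w) j z = dZb n f j z - dZb n g j z := by
  simp only [dZb, fderiv_fun_sub hf hg, sub_apply]
  ring

theorem dZb_add (hf : DifferentiableAt ℝ f z) (hg : DifferentiableAt ℝ g z) (j : Fin n) :
    dZb n (fun w => f w + g w) j z = dZb n f j z + dZb n g j z := by
  simp only [dZb, fderiv_fun_add hf hg, add_apply]
  ring

theorem dZ_mul (hf : DifferentiableAt ℝ f z) (hg : DifferentiableAt ℝ g z) (j : Fin n) :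
    dZ n (fun w => f w * g w) j z = dZ n f j z * g z + f z * dZ n g j z := by
  simp only [dZ, fderiv_fun_mul hf hg, add_apply,
    smul_apply, smul_eq_mul]
  ring

theorem dZb_mul (hf : DifferentiableAt ℝ f z) (hg : DifferentiableAt ℝ g z) (j : Fin n) :
    dZb n (fun w => f w * g w) j z = dZb n f j z * g z + f z * dZb n g j z := by
  simp only [dZb, fderiv_fun_mul hf hg, add_apply,
    smul_apply, smul_eq_mul]
  ring

theorem dZ_const (c : ℂ) (j : Fin n) : dZ n (fun _ => c) j z = 0 := by
  simp [dZ]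

theorem dZ_sum {ι : Type*} (s : Finset ι) {F : ι → Pt n → ℂ}
    (hF : ∀ i ∈ s, DifferentiableAt ℝ (F i) z) (j : Fin n) :
    dZ n (fun w => ∑ i ∈ s, F i w) j z = ∑ i ∈ s, dZ n (F i) j z := by
  simp only [dZ, fderiv_fun_sum hF, sum_apply, Finset.mul_sum,
    ← Finset.sum_sub_distrib]

theorem dZ_congr (h : f =ᶠ[nhds z] g) (j : Fin n) : dZ n f j z = dZ n g j z := by
  simp only [dZ, h.fderiv_eq]

theorem fderiv_conj_apply (v : Pt n) :
    fderiv ℝ (fun w => (starRingEnd ℂ) (f w)) z v = (starRingEnd ℂ) (fderiv ℝ f z v) := by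
  have h := Complex.conjCLE.comp_fderiv (f := f) (x := z)
  have h' : (fun w => (starRingEnd ℂ) (f w)) = Complex.conjCLE ∘ f := by
    funext w; simp
  rw [h', h]
  simp

theorem dZ_conj (j : Fin n) :
    dZ n (fun w => (starRingEnd ℂ) (f w)) j z = (starRingEnd ℂ) (dZb n f j z) := by
  simp [dZ, dZb, fderiv_conj_apply, map_ofNat]
  ring

theorem dZb_conj (j : Fin n) :
    dZb n (fun w => (starRingEnd ℂ) (f w)) j z = (starRingEnd ℂ) (dZ n f j z) := by
  simp [dZ, dZb, fderiv_conj_apply, map_ofNat]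

theorem dZ_neg (j : Fin n) : dZ n (fun w => -f w) j z = -dZ n f j z := by
  simp only [dZ, fderiv_fun_neg, neg_apply]
  ring

theorem dZb_neg (j : Fin n) : dZb n (fun w => -f w) j z = -dZb n f j z := by
  simp only [dZb, fderiv_fun_neg, neg_apply]
  ring

theorem conj_dZ_cR (r : Pt n → ℝ) (j : Fin n) :
    (starRingEnd ℂ) (dZ n (cR n r) j z) = dZb n (cR n r) j z := by
  rw [← dZb_conj]
  simp only [cR, Complex.conj_ofReal]
  rfl

theorem conj_dZb_cR (r : Pt n → ℝ) (j : Fin n) :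
    (starRingEnd ℂ) (dZb n (cR n r) j z) = dZ n (cR n r) j z := by
  rw [← conj_dZ_cR, Complex.conj_conj]

theorem contDiffAt_fderiv_apply {m : ℕ} (hf : ContDiffAt ℝ (m + 1 : ℕ) f z) (v : Pt n) :
    ContDiffAt ℝ m (fun w => fderiv ℝ f w v) z :=
  (hf.fderiv_right (m := m) (by norm_cast)).clm_apply contDiffAt_const

theorem contDiffAt_dZ {m : ℕ} (hf : ContDiffAt ℝ (m + 1 : ℕ) f z) (j : Fin n) :
    ContDiffAt ℝ m (fun w => dZ n f j w) z :=
  contDiffAt_const.mul ((contDiffAt_fderiv_apply hf _).sub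
    (contDiffAt_const.mul (contDiffAt_fderiv_apply hf _)))

theorem contDiffAt_dZb {m : ℕ} (hf : ContDiffAt ℝ (m + 1 : ℕ) f z) (j : Fin n) :
    ContDiffAt ℝ m (fun w => dZb n f j w) z :=
  contDiffAt_const.mul ((contDiffAt_fderiv_apply hf _).add
    (contDiffAt_const.mul (contDiffAt_fderiv_apply hf _)))

theorem contDiffAt_div {m : WithTop ℕ∞} (hf : ContDiffAt ℝ m f z) (hg : ContDiffAt ℝ m g z)
    (h0 : g z ≠ 0) : ContDiffAt ℝ m (fun w => f w / g w) z := by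
  simp only [div_eq_mul_inv]
  exact hf.mul (hg.inv h0)

theorem contDiffAt_cR {m : ℕ} {r : Pt n → ℝ} (hr : ContDiffAt ℝ m r z) :
    ContDiffAt ℝ m (cR n r) z :=
  Complex.ofRealCLM.contDiff.contDiffAt.comp z hr

theorem fderiv_fderiv_apply (hf : ContDiffAt ℝ (2 : ℕ) f z) (u v : Pt n) :
    fderiv ℝ (fun w => fderiv ℝ f w v) z u = fderiv ℝ (fderiv ℝ f) z u v := by
  have h : DifferentiableAt ℝ (fderiv ℝ f) z :=
    (hf.fderiv_right (m := (1 : ℕ)) (by norm_cast)).differentiableAt (by norm_num)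
  rw [fderiv_clm_apply h (differentiableAt_const v)]
  simp

theorem differentiableAt_fderiv_apply (hf : ContDiffAt ℝ (2 : ℕ) f z) (v : Pt n) :
    DifferentiableAt ℝ (fun w => fderiv ℝ f w v) z :=
  (contDiffAt_fderiv_apply (m := 1) hf v).differentiableAt (by norm_num)

theorem fderiv_dZ_apply (hf : ContDiffAt ℝ (2 : ℕ) f z) (j : Fin n) (u : Pt n) :
    fderiv ℝ (fun w => dZ n f j w) z u = (1 / 2 : ℂ) *
      (fderiv ℝ (fderiv ℝ f) z u (Pi.single j 1)
        - Complex.I * fderiv ℝ (fderiv ℝ f) z u (Pi.single j Complex.I)) := by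
  have h := differentiableAt_fderiv_apply hf
  simp only [dZ]
  rw [fderiv_const_mul ((h _).fun_sub ((h _).const_mul _)),
    fderiv_fun_sub (h _) ((h _).const_mul _), fderiv_const_mul (h _)]
  simp [fderiv_fderiv_apply hf]

theorem fderiv_dZb_apply (hf : ContDiffAt ℝ (2 : ℕ) f z) (j : Fin n) (u : Pt n) :
    fderiv ℝ (fun w => dZb n f j w) z u = (1 / 2 : ℂ) *
      (fderiv ℝ (fderiv ℝ f) z u (Pi.single j 1)
        + Complex.I * fderiv ℝ (fderiv ℝ f) z u (Pi.single j Complex.I)) := by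
  have h := differentiableAt_fderiv_apply hf
  simp only [dZb]
  rw [fderiv_const_mul ((h _).fun_add ((h _).const_mul _)),
    fderiv_fun_add (h _) ((h _).const_mul _), fderiv_const_mul (h _)]
  simp [fderiv_fderiv_apply hf]
  ring

theorem fderiv_fderiv_comm (hf : ContDiffAt ℝ (2 : ℕ) f z) (u v : Pt n) :
    fderiv ℝ (fderiv ℝ f) z u v = fderiv ℝ (fderiv ℝ f) z v u :=
  (hf.isSymmSndFDerivAt (by simp)).eq u v

theorem dZ_dZ_comm (hf : ContDiffAt ℝ (2 : ℕ) f z) (j m : Fin n) :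
    dZ n (fun w => dZ n f m w) j z = dZ n (fun w => dZ n f j w) m z := by
  rw [dZ, dZ]
  simp only [fderiv_dZ_apply hf]
  rw [fderiv_fderiv_comm hf (Pi.single j 1) (Pi.single m 1),
    fderiv_fderiv_comm hf (Pi.single j 1) (Pi.single m Complex.I),
    fderiv_fderiv_comm hf (Pi.single j Complex.I) (Pi.single m 1),
    fderiv_fderiv_comm hf (Pi.single j Complex.I) (Pi.single m Complex.I)]
  ring

theorem dZ_dZb_comm (hf : ContDiffAt ℝ (2 : ℕ) f z) (j m : Fin n) :
    dZ n (fun w => dZb n f m w) j z = dZb n (fun w => dZ n f j w) m z := by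
  rw [dZ, dZb]
  simp only [fderiv_dZ_apply hf, fderiv_dZb_apply hf]
  rw [fderiv_fderiv_comm hf (Pi.single j 1) (Pi.single m 1),
    fderiv_fderiv_comm hf (Pi.single j 1) (Pi.single m Complex.I),
    fderiv_fderiv_comm hf (Pi.single j Complex.I) (Pi.single m 1),
    fderiv_fderiv_comm hf (Pi.single j Complex.I) (Pi.single m Complex.I)]
  ring

theorem fderiv_cR_apply {r : Pt n → ℝ} (hr : DifferentiableAt ℝ r z) (v : Pt n) :
    fderiv ℝ (cR n r) z v = (fderiv ℝ r z v : ℂ) := by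
  have h : HasFDerivAt (cR n r) (Complex.ofRealCLM.comp (fderiv ℝ r z)) z :=
    Complex.ofRealCLM.hasFDerivAt.comp z hr.hasFDerivAt
  rw [h.fderiv]
  simp

theorem gradSq_eq_sum (r : Pt n → ℝ) :
    (gradSq n r z : ℂ) = ∑ j, dZ n (cR n r) j z * dZb n (cR n r) j z := by
  simp [gradSq, ← conj_dZ_cR, Complex.mul_conj]

theorem gradSq_ne_zero {r : Pt n → ℝ} (hr : DifferentiableAt ℝ r z) (h0 : fderiv ℝ r z ≠ 0) :
    gradSq n r z ≠ 0 := by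
  contrapose! h0
  rw [gradSq, Finset.sum_eq_zero_iff_of_nonneg (fun _ _ => Complex.normSq_nonneg _)] at h0
  have key : ∀ j, fderiv ℝ r z (Pi.single j 1) = 0 ∧
      fderiv ℝ r z (Pi.single j Complex.I) = 0 := by
    intro j
    have h := Complex.normSq_eq_zero.1 (h0 j (Finset.mem_univ j))
    rw [dZ, fderiv_cR_apply hr, fderiv_cR_apply hr] at h
    have hre := congrArg Complex.re h
    have him := congrArg Complex.im h
    simp at hre him
    exact ⟨hre, him⟩
  ext v
  have hv : v = ∑ j, ((v j).re • (Pi.single j 1 : Pt n)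
      + (v j).im • (Pi.single j Complex.I : Pt n)) := by
    ext i
    simp [Finset.sum_apply, Pi.single_apply, Finset.sum_add_distrib, Complex.re_add_im]
  rw [hv, map_sum]
  simp [key]

end Wirtinger

section DAngelo

variable {n : ℕ} {z : Pt n}

theorem dAngelo_t_eq_conj (r : Pt n → ℝ) (j : Fin n) :
    (dAngelo n r).t z j = (starRingEnd ℂ) ((dAngelo n r).w z j) := by
  have h1 : ∀ m, (fun w => (etaF n r).t w m)
      = fun w => -(starRingEnd ℂ) ((etaF n r).w w m) := by
    intro m; funext w
    simp [etaF, conj_dZ_cR, map_ofNat]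
  have h1' : ∀ m, (etaF n r).t z m = -(starRingEnd ℂ) ((etaF n r).w z m) :=
    fun m => congrFun (h1 m) z
  have h2 : ∀ m, (fun w => (TVF n r).b w m)
      = fun w => -(starRingEnd ℂ) ((TVF n r).a w m) := fun m => rfl
  have h2' : ∀ m, (TVF n r).b z m = -(starRingEnd ℂ) ((TVF n r).a z m) := fun m => rfl
  simp only [dAngelo, Form1.neg, lieD, VF.app, h1, h1', h2, h2', dZ_neg, dZb_neg, dZ_conj,
    dZb_conj, map_neg, map_add, map_sum, map_mul, Complex.conj_conj]
  simp only [mul_neg, neg_mul, neg_neg, Finset.sum_neg_distrib]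
  ring

theorem contDiffAt_gradSq {r : Pt n → ℝ} {m : ℕ} (hr : ContDiffAt ℝ (m + 1 : ℕ) r z) :
    ContDiffAt ℝ m (fun w => (gradSq n r w : ℂ)) z := by
  simp only [gradSq_eq_sum]
  exact ContDiffAt.sum fun j _ =>
    (contDiffAt_dZ (contDiffAt_cR hr) j).mul (contDiffAt_dZb (contDiffAt_cR hr) j)

theorem eta_T_pairing {r : Pt n → ℝ} (h0 : gradSq n r z ≠ 0) :
    ∑ m, ((etaF n r).w z m * (TVF n r).a z m + (etaF n r).t z m * (TVF n r).b z m) = 1 := by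
  have h0' : (gradSq n r z : ℂ) ≠ 0 := by exact_mod_cast h0
  have : ∀ m, (etaF n r).w z m * (TVF n r).a z m + (etaF n r).t z m * (TVF n r).b z m
      = dZ n (cR n r) m z * dZb n (cR n r) m z / (gradSq n r z : ℂ) := by
    intro m
    simp only [etaF, TVF, LnVF, map_div₀, Complex.conj_ofReal, conj_dZb_cR]
    ring
  simp only [this]
  rw [← Finset.sum_div, ← gradSq_eq_sum, div_self h0']

theorem dAngelo_w_eq {r : Pt n → ℝ} (hr : ContDiffAt ℝ (2 : ℕ) r z) (h0 : gradSq n r z ≠ 0)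
    (j : Fin n) :
    (dAngelo n r).w z j = (∑ m, dZ n (cR n r) m z *
      dZ n (fun w => dZb n (cR n r) m w) j z) / (gradSq n r z : ℂ) := by
  have hc := contDiffAt_cR hr
  have h0' : (gradSq n r z : ℂ) ≠ 0 := by exact_mod_cast h0
  have hg := (contDiffAt_gradSq (m := 1) hr)
  have hdz : ∀ m, DifferentiableAt ℝ (fun w => dZ n (cR n r) m w) z := fun m =>
    (contDiffAt_dZ (m := 1) hc m).differentiableAt (by norm_num)
  have hdzb : ∀ m, DifferentiableAt ℝ (fun w => dZb n (cR n r) m w) z := fun m =>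
    (contDiffAt_dZb (m := 1) hc m).differentiableAt (by norm_num)
  have hw : ∀ m, DifferentiableAt ℝ (fun w => (etaF n r).w w m) z := fun m =>
    (hdz m).const_mul _
  have ht : ∀ m, DifferentiableAt ℝ (fun w => (etaF n r).t w m) z := fun m =>
    (hdzb m).const_mul _
  have ha : ∀ m, DifferentiableAt ℝ (fun w => (TVF n r).a w m) z := fun m =>
    (contDiffAt_div (contDiffAt_dZb (m := 1) hc m) hg h0').differentiableAt (by norm_num)
  have hb : ∀ m, DifferentiableAt ℝ (fun w => (TVF n r).b w m) z := fun m =>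
    (Complex.conjCLE.differentiableAt.comp z (ha m)).neg
  have hev : ∀ᶠ w in nhds z, gradSq n r w ≠ 0 := by
    filter_upwards [hg.continuousAt.eventually_ne h0'] with w hw'
    exact_mod_cast hw'
  have hone := dZ_congr (j := j) (hev.mono fun w hw' => eta_T_pairing hw')
  rw [dZ_const, dZ_sum _ (fun m _ => ((hw m).fun_mul (ha m)).fun_add ((ht m).fun_mul (hb m)))] at hone
  have hsum : ∀ m, dZ n (fun w => (etaF n r).w w m * (TVF n r).a w m
        + (etaF n r).t w m * (TVF n r).b w m) j z
      = (etaF n r).w z m * dZ n (fun w => (TVF n r).a w m) j z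
        + (etaF n r).t z m * dZ n (fun w => (TVF n r).b w m) j z
        + (dZ n (fun w => (etaF n r).w w m) j z * (TVF n r).a z m
        + dZ n (fun w => (etaF n r).t w m) j z * (TVF n r).b z m) := by
    intro m
    rw [dZ_add ((hw m).fun_mul (ha m)) ((ht m).fun_mul (hb m)), dZ_mul (hw m) (ha m),
      dZ_mul (ht m) (hb m)]
    ring
  simp only [hsum, Finset.sum_add_distrib] at hone
  simp only [dAngelo, Form1.neg, lieD, VF.app]
  have e1 : ∀ m i, dZ n (fun w => (etaF n r).w w m) i z
      = 1 / 2 * dZ n (fun w => dZ n (cR n r) i w) m z := by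
    intro m i
    simp only [etaF]
    rw [dZ_mul (differentiableAt_const _) (hdz m), dZ_const, dZ_dZ_comm hc]
    ring
  have e2 : ∀ i, dZb n (fun w => (etaF n r).w w j) i z
      = 1 / 2 * dZ n (fun w => dZb n (cR n r) i w) j z := by
    intro i
    simp only [etaF]
    rw [dZb_mul (differentiableAt_const _) (hdz j), dZ_dZb_comm hc]
    simp [dZb]
  have e3 : ∀ m, dZ n (fun w => (etaF n r).t w m) j z
      = -(1 / 2) * dZ n (fun w => dZb n (cR n r) m w) j z := by
    intro m
    simp only [etaF]
    rw [dZ_mul (differentiableAt_const _) (hdzb m), dZ_const]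
    ring
  have e4 : ∀ m, (TVF n r).b z m = - (dZ n (cR n r) m z / (gradSq n r z : ℂ)) := by
    intro m
    simp only [TVF, LnVF, map_div₀, Complex.conj_ofReal, conj_dZb_cR]
  have e5 : ∀ m, dZ n (fun w => (etaF n r).w w j) m z
      = dZ n (fun w => (etaF n r).w w m) j z := by
    intro m
    rw [e1, e1, dZ_dZ_comm hc]
  have e6 : ∀ m, dZ n (fun w => (etaF n r).w w m) j z * (TVF n r).a z m
      = (TVF n r).a z m * dZ n (fun w => (etaF n r).w w m) j z := fun m => mul_comm _ _
  have e7 : ∀ m, dZ n (fun w => (etaF n r).t w m) j z * (TVF n r).b z m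
      = 1 / 2 * (dZ n (cR n r) m z * dZ n (fun w => dZb n (cR n r) m w) j z
        / (gradSq n r z : ℂ)) := by
    intro m
    rw [e3, e4]; ring
  have e8 : ∀ m, (TVF n r).b z m * dZb n (fun w => (etaF n r).w w j) m z
      = -(1 / 2) * (dZ n (cR n r) m z * dZ n (fun w => dZb n (cR n r) m w) j z
        / (gradSq n r z : ℂ)) := by
    intro m
    rw [e2, e4]; ring
  simp only [e6, e7, ← Finset.mul_sum, ← Finset.sum_div] at hone
  simp only [e5, e8, ← Finset.mul_sum, ← Finset.sum_div]
  linear_combination -hone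

theorem contDiffAt_dAngelo_w {r : Pt n → ℝ} (hr : ContDiffAt ℝ (3 : ℕ) r z)
    (h0 : gradSq n r z ≠ 0) (j : Fin n) :
    ContDiffAt ℝ 1 (fun w => (dAngelo n r).w w j) z := by
  have hc := contDiffAt_cR hr
  have h0' : (gradSq n r z : ℂ) ≠ 0 := by exact_mod_cast h0
  have hg : ContDiffAt ℝ (1 : ℕ) (fun w => (gradSq n r w : ℂ)) z :=
    (contDiffAt_gradSq (m := 2) hr).of_le (by norm_cast)
  have hr2 : ContDiffAt ℝ (2 : ℕ) r z := hr.of_le (by norm_cast)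
  have hev : ∀ᶠ w in nhds z, (dAngelo n r).w w j = (∑ m, dZ n (cR n r) m w *
      dZ n (fun w => dZb n (cR n r) m w) j w) / (gradSq n r w : ℂ) := by
    filter_upwards [hg.continuousAt.eventually_ne h0', hr2.eventually (by simp)] with w hw hw2
    exact dAngelo_w_eq hw2 (by exact_mod_cast hw) j
  refine ContDiffAt.congr_of_eventuallyEq ?_ hev
  refine contDiffAt_div (g := fun w => (gradSq n r w : ℂ)) (ContDiffAt.sum fun m _ => ?_)
    (by exact_mod_cast hg) h0'
  exact ((contDiffAt_dZ (m := 2) hc m).of_le (by norm_cast)).mul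
    (by exact_mod_cast contDiffAt_dZ (m := 1) (contDiffAt_dZb (m := 2) hc m) j)

end DAngelo

section ChangeOfDefiningFunction

variable {n : ℕ} {z : Pt n} {ρ ρt ψ : Pt n → ℝ}

theorem fderiv_cexp_cR (hψ : DifferentiableAt ℝ ψ z) (v : Pt n) :
    fderiv ℝ (fun w => Complex.exp (cR n ψ w)) z v
      = Complex.exp (cR n ψ z) * fderiv ℝ (cR n ψ) z v := by
  have hc : DifferentiableAt ℝ (cR n ψ) z :=
    Complex.ofRealCLM.differentiableAt.comp z hψ
  rw [hc.hasFDerivAt.cexp.fderiv]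
  simp

theorem dZ_cexp_cR (hψ : DifferentiableAt ℝ ψ z) (j : Fin n) :
    dZ n (fun w => Complex.exp (cR n ψ w)) j z
      = Complex.exp (cR n ψ z) * dZ n (cR n ψ) j z := by
  simp only [dZ, fderiv_cexp_cR hψ]
  ring

theorem differentiableAt_cR (hψ : DifferentiableAt ℝ ψ z) : DifferentiableAt ℝ (cR n ψ) z :=
  Complex.ofRealCLM.differentiableAt.comp z hψ

theorem dZ_mul_exp (heq : ∀ z, ρt z = ρ z * Real.exp (ψ z)) (hρ : DifferentiableAt ℝ ρ z)
    (hψ : DifferentiableAt ℝ ψ z) (j : Fin n) :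
    dZ n (cR n ρt) j z = Complex.exp (cR n ψ z) *
      (dZ n (cR n ρ) j z + cR n ρ z * dZ n (cR n ψ) j z) := by
  have h : cR n ρt = fun w => cR n ρ w * Complex.exp (cR n ψ w) := by
    funext w; simp [cR, heq]
  rw [h, dZ_mul (differentiableAt_cR hρ) (differentiableAt_cR hψ).cexp, dZ_cexp_cR hψ]
  ring

theorem dZb_mul_exp (heq : ∀ z, ρt z = ρ z * Real.exp (ψ z)) (hρ : DifferentiableAt ℝ ρ z)
    (hψ : DifferentiableAt ℝ ψ z) (j : Fin n) :
    dZb n (cR n ρt) j z = Complex.exp (cR n ψ z) *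
      (dZb n (cR n ρ) j z + cR n ρ z * dZb n (cR n ψ) j z) := by
  rw [← conj_dZ_cR, dZ_mul_exp heq hρ hψ, ← conj_dZ_cR, ← conj_dZ_cR]
  simp [cR, ← Complex.exp_conj]

theorem dZ_dZb_mul_exp (heq : ∀ z, ρt z = ρ z * Real.exp (ψ z)) (hρ : ContDiffAt ℝ (2 : ℕ) ρ z)
    (hψ : ContDiffAt ℝ (2 : ℕ) ψ z) (h0 : ρ z = 0) (j m : Fin n) :
    dZ n (fun w => dZb n (cR n ρt) m w) j z = Complex.exp (cR n ψ z) *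
      (dZ n (cR n ψ) j z * dZb n (cR n ρ) m z + dZ n (fun w => dZb n (cR n ρ) m w) j z
        + dZ n (cR n ρ) j z * dZb n (cR n ψ) m z) := by
  have hev : (fun w => dZb n (cR n ρt) m w) =ᶠ[nhds z] fun w => Complex.exp (cR n ψ w) *
      (dZb n (cR n ρ) m w + cR n ρ w * dZb n (cR n ψ) m w) := by
    filter_upwards [hρ.eventually (by simp), hψ.eventually (by simp)] with w h1 h2
    exact dZb_mul_exp heq (h1.differentiableAt (by norm_num))
      (h2.differentiableAt (by norm_num)) m
  have dρ := differentiableAt_cR (hρ.differentiableAt (by norm_num))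
  have dψ := differentiableAt_cR (hψ.differentiableAt (by norm_num))
  have dbρ : DifferentiableAt ℝ (fun w => dZb n (cR n ρ) m w) z :=
    (contDiffAt_dZb (m := 1) (contDiffAt_cR hρ) m).differentiableAt (by norm_num)
  have dbψ : DifferentiableAt ℝ (fun w => dZb n (cR n ψ) m w) z :=
    (contDiffAt_dZb (m := 1) (contDiffAt_cR hψ) m).differentiableAt (by norm_num)
  have hz : cR n ρ z = 0 := by simp [cR, h0]
  rw [dZ_congr hev, dZ_mul dψ.cexp (dbρ.fun_add (dρ.fun_mul dbψ)),
    dZ_cexp_cR (hψ.differentiableAt (by norm_num)), dZ_add dbρ (dρ.fun_mul dbψ), dZ_mul dρ dbψ, hz]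
  ring

theorem gradSq_mul_exp (heq : ∀ z, ρt z = ρ z * Real.exp (ψ z)) (hρ : DifferentiableAt ℝ ρ z)
    (hψ : DifferentiableAt ℝ ψ z) (h0 : ρ z = 0) :
    (gradSq n ρt z : ℂ) = Complex.exp (cR n ψ z) ^ 2 * (gradSq n ρ z : ℂ) := by
  have hz : cR n ρ z = 0 := by simp [cR, h0]
  rw [gradSq_eq_sum, gradSq_eq_sum, Finset.mul_sum]
  refine Finset.sum_congr rfl fun j _ => ?_
  rw [dZ_mul_exp heq hρ hψ, dZb_mul_exp heq hρ hψ, hz]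
  ring

/-- The factor `c` such that the D'Angelo form changes by `∂ψ + c ∂ρ` on the boundary. -/
noncomputable def normalFactor (n : ℕ) (ρ ψ : Pt n → ℝ) (z : Pt n) : ℂ :=
  (∑ m, dZ n (cR n ρ) m z * dZb n (cR n ψ) m z) / (gradSq n ρ z : ℂ)

theorem dAngelo_w_mul_exp (heq : ∀ z, ρt z = ρ z * Real.exp (ψ z))
    (hρ : ContDiffAt ℝ (2 : ℕ) ρ z) (hρt : ContDiffAt ℝ (2 : ℕ) ρt z)
    (hψ : ContDiffAt ℝ (2 : ℕ) ψ z) (h0 : ρ z = 0) (hg : gradSq n ρ z ≠ 0) (j : Fin n) :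
    (dAngelo n ρt).w z j = (dAngelo n ρ).w z j + dZ n (cR n ψ) j z
      + normalFactor n ρ ψ z * dZ n (cR n ρ) j z := by
  have dρ := hρ.differentiableAt (by norm_num)
  have dψ := hψ.differentiableAt (by norm_num)
  have hz : cR n ρ z = 0 := by simp [cR, h0]
  have hg' : (gradSq n ρ z : ℂ) ≠ 0 := by exact_mod_cast hg
  have hE := Complex.exp_ne_zero (cR n ψ z)
  have hgt := gradSq_mul_exp heq dρ dψ h0
  have hgt' : gradSq n ρt z ≠ 0 := by
    have : (gradSq n ρt z : ℂ) ≠ 0 := hgt ▸ mul_ne_zero (pow_ne_zero 2 hE) hg'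
    exact_mod_cast this
  rw [dAngelo_w_eq hρt hgt', dAngelo_w_eq hρ hg, hgt, normalFactor]
  have hs : ∑ m, dZ n (cR n ρt) m z * dZ n (fun w => dZb n (cR n ρt) m w) j z
      = Complex.exp (cR n ψ z) ^ 2 *
        (dZ n (cR n ψ) j z * (gradSq n ρ z : ℂ)
          + ∑ m, dZ n (cR n ρ) m z * dZ n (fun w => dZb n (cR n ρ) m w) j z
          + dZ n (cR n ρ) j z * ∑ m, dZ n (cR n ρ) m z * dZb n (cR n ψ) m z) := by
    rw [gradSq_eq_sum]
    simp only [Finset.mul_sum, ← Finset.sum_add_distrib]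
    refine Finset.sum_congr rfl fun m _ => ?_
    rw [dZ_mul_exp heq dρ dψ, dZ_dZb_mul_exp heq hρ hψ h0, hz]
    ring
  rw [hs]
  field_simp
  ring

/-- A real function vanishing on a regular level set has differential proportional to that of the
function defining the level set. -/
theorem exists_fderiv_eq_smul_of_vanishing {u : Pt n → ℝ} (hu : ContDiffAt ℝ 1 u z)
    (hρ : ContDiffAt ℝ 1 ρ z) (h0 : ρ z = 0) (hd : fderiv ℝ ρ z ≠ 0)
    (hvan : ∀ᶠ w in nhds z, ρ w = 0 → u w = 0) :
    ∃ b : ℝ, fderiv ℝ u z = b • fderiv ℝ ρ z := by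
  have huz : u z = 0 := hvan.self_of_nhds h0
  have hext : IsLocalExtrOn u {w | ρ w = ρ z} z := by
    left
    have hv : ∀ᶠ w in nhdsWithin z {w | ρ w = ρ z}, u z ≤ u w := by
      filter_upwards [nhdsWithin_le_nhds hvan, self_mem_nhdsWithin] with w hw hmem
      rw [huz, hw (by rw [← h0]; exact hmem)]
    exact hv
  obtain ⟨a, b, hab, hlin⟩ := hext.exists_multipliers_of_hasStrictFDerivAt_1d
    (hρ.hasStrictFDerivAt (by norm_num)) (hu.hasStrictFDerivAt (by norm_num))
  have hb : b ≠ 0 := by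
    rintro rfl
    have ha : a ≠ 0 := by rintro rfl; exact hab rfl
    rw [zero_smul, add_zero] at hlin
    exact hd ((smul_eq_zero.1 hlin).resolve_left ha)
  refine ⟨-(b⁻¹ * a), ?_⟩
  have : b⁻¹ • (a • fderiv ℝ ρ z + b • fderiv ℝ u z) = 0 := by rw [hlin, smul_zero]
  rw [smul_add, smul_smul, smul_smul, inv_mul_cancel₀ hb, one_smul] at this
  ext v
  have hv := congrArg (fun l => l v) this
  simp at hv ⊢
  linarith

theorem exists_dZb_eq_mul_of_vanishing {f : Pt n → ℂ} (hf : ContDiffAt ℝ 1 f z)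
    (hρ : ContDiffAt ℝ 1 ρ z) (h0 : ρ z = 0) (hd : fderiv ℝ ρ z ≠ 0)
    (hvan : ∀ᶠ w in nhds z, ρ w = 0 → f w = 0) :
    ∃ b : ℂ, ∀ m, dZb n f m z = b * dZb n (cR n ρ) m z := by
  obtain ⟨b₁, h₁⟩ := exists_fderiv_eq_smul_of_vanishing (u := fun w => (f w).re)
    (Complex.reCLM.contDiff.contDiffAt.comp z hf) hρ h0 hd
    (hvan.mono fun w hw h => by simp [hw h])
  obtain ⟨b₂, h₂⟩ := exists_fderiv_eq_smul_of_vanishing (u := fun w => (f w).im)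
    (Complex.imCLM.contDiff.contDiffAt.comp z hf) hρ h0 hd
    (hvan.mono fun w hw h => by simp [hw h])
  have hfd := (hf.differentiableAt (by norm_num)).hasFDerivAt
  have hre : fderiv ℝ (fun w => (f w).re) z = Complex.reCLM.comp (fderiv ℝ f z) :=
    (Complex.reCLM.hasFDerivAt.comp z hfd).fderiv
  have him : fderiv ℝ (fun w => (f w).im) z = Complex.imCLM.comp (fderiv ℝ f z) :=
    (Complex.imCLM.hasFDerivAt.comp z hfd).fderiv
  rw [hre] at h₁
  rw [him] at h₂
  have key : ∀ v, fderiv ℝ f z v = (b₁ + b₂ * Complex.I) * fderiv ℝ (cR n ρ) z v := by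
    intro v
    have e₁ := congrArg (fun l => l v) h₁
    have e₂ := congrArg (fun l => l v) h₂
    simp at e₁ e₂
    rw [fderiv_cR_apply (hρ.differentiableAt (by norm_num))]
    apply Complex.ext
    · simp [e₁]
    · simp [e₂]
  refine ⟨b₁ + b₂ * Complex.I, fun m => ?_⟩
  simp only [dZb, key]
  ring

theorem contDiffAt_normalFactor (hρ : ContDiffAt ℝ (2 : ℕ) ρ z) (hψ : ContDiffAt ℝ (2 : ℕ) ψ z)
    (hg : gradSq n ρ z ≠ 0) : ContDiffAt ℝ 1 (normalFactor n ρ ψ) z := by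
  refine contDiffAt_div (g := fun w => (gradSq n ρ w : ℂ))
    (ContDiffAt.sum fun m _ => ContDiffAt.mul ?_ ?_) ?_ (by exact_mod_cast hg)
  · exact_mod_cast contDiffAt_dZ (m := 1) (contDiffAt_cR hρ) m
  · exact_mod_cast contDiffAt_dZb (m := 1) (contDiffAt_cR hψ) m
  · exact_mod_cast contDiffAt_gradSq (m := 1) hρ

theorem sum_conj_mul_dZb_eq_zero {X : Fin n → ℂ} (hX : X ∈ T10 n ρ z) :
    ∑ m, dZb n (cR n ρ) m z * (starRingEnd ℂ) (X m) = 0 := by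
  have h := congrArg (starRingEnd ℂ) (show ∑ j, X j * dZ n (cR n ρ) j z = 0 from hX)
  simp only [map_sum, map_mul, conj_dZ_cR, map_zero] at h
  rw [← h]
  exact Finset.sum_congr rfl fun m _ => mul_comm _ _

theorem conj_levi (r : Pt n → ℝ) (X : Fin n → ℂ) :
    (starRingEnd ℂ) (levi n r z X X)
      = ∑ m, ∑ l, dZb n (fun w => dZ n (cR n r) l w) m z * ((starRingEnd ℂ) (X m) * X l) := by
  simp only [levi, map_sum, map_mul, Complex.conj_conj, ← dZb_conj, conj_dZb_cR]
  exact Finset.sum_congr rfl fun m _ => Finset.sum_congr rfl fun l _ => by ring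

theorem sum_dZb_dAngelo_w_mul_exp (heq : ∀ z, ρt z = ρ z * Real.exp (ψ z))
    (hρ : ContDiffAt ℝ (3 : ℕ) ρ z) (hρt : ContDiffAt ℝ (3 : ℕ) ρt z)
    (hψ : ContDiffAt ℝ (2 : ℕ) ψ z) (h0 : ρ z = 0) (hd : fderiv ℝ ρ z ≠ 0)
    (hdt : fderiv ℝ ρt z ≠ 0) {X : Fin n → ℂ} (hX : X ∈ nullSp n ρ z) :
    ∑ m, ∑ l, dZb n (fun w => (dAngelo n ρt).w w l) m z * ((starRingEnd ℂ) (X m) * X l)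
      = ∑ m, ∑ l, dZb n (fun w => (dAngelo n ρ).w w l) m z * ((starRingEnd ℂ) (X m) * X l)
        + (starRingEnd ℂ) (levi n ψ z X X) := by
  have hρ2 : ContDiffAt ℝ (2 : ℕ) ρ z := hρ.of_le (by norm_cast)
  have hρt2 : ContDiffAt ℝ (2 : ℕ) ρt z := hρt.of_le (by norm_cast)
  have hg := gradSq_ne_zero (hρ.differentiableAt (by norm_num)) hd
  have hgt := gradSq_ne_zero (hρt.differentiableAt (by norm_num)) hdt
  have hA := contDiffAt_dAngelo_w hρ hg
  have hAt := contDiffAt_dAngelo_w hρt hgt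
  have hc := contDiffAt_normalFactor hρ2 hψ hg
  have hdψ : ∀ l, ContDiffAt ℝ 1 (fun w => dZ n (cR n ψ) l w) z := fun l => by
    exact_mod_cast contDiffAt_dZ (m := 1) (contDiffAt_cR hψ) l
  have hdρ : ∀ l, ContDiffAt ℝ 1 (fun w => dZ n (cR n ρ) l w) z := fun l => by
    exact_mod_cast contDiffAt_dZ (m := 1) (contDiffAt_cR hρ2) l
  have hgev : ∀ᶠ w in nhds z, gradSq n ρ w ≠ 0 := by
    have hg' : (gradSq n ρ z : ℂ) ≠ 0 := by exact_mod_cast hg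
    filter_upwards [(contDiffAt_gradSq (m := 1) hρ2).continuousAt.eventually_ne hg']
      with w hw
    exact_mod_cast hw
  have hb : ∀ l, ∃ b : ℂ, ∀ m, dZb n (fun w => (dAngelo n ρt).w w l - ((dAngelo n ρ).w w l
      + dZ n (cR n ψ) l w + normalFactor n ρ ψ w * dZ n (cR n ρ) l w)) m z
        = b * dZb n (cR n ρ) m z := by
    intro l
    refine exists_dZb_eq_mul_of_vanishing
      ((hAt l).sub (((hA l).add (hdψ l)).add (hc.mul (hdρ l))))
      (hρ.of_le (by norm_cast)) h0 hd ?_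
    filter_upwards [hgev, hρ2.eventually (by simp), hρt2.eventually (by simp),
      hψ.eventually (by simp)] with w h1 h2 h3 h4 h5
    rw [dAngelo_w_mul_exp heq h2 h3 h4 h5 h1, sub_self]
  choose b hb using hb
  have hone : (1 : WithTop ℕ∞) ≠ 0 := by norm_num
  have hb' : ∀ m l, dZb n (fun w => (dAngelo n ρt).w w l) m z
      = dZb n (fun w => (dAngelo n ρ).w w l) m z + dZb n (fun w => dZ n (cR n ψ) l w) m z
        + dZb n (normalFactor n ρ ψ) m z * dZ n (cR n ρ) l z
        + normalFactor n ρ ψ z * dZb n (fun w => dZ n (cR n ρ) l w) m z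
        + b l * dZb n (cR n ρ) m z := by
    intro m l
    have h := hb l m
    have d1 := (hA l).differentiableAt hone
    have d2 := (hAt l).differentiableAt hone
    have d3 := (hdψ l).differentiableAt hone
    have d4 := (hdρ l).differentiableAt hone
    have d5 := hc.differentiableAt hone
    rw [dZb_sub d2 ((d1.fun_add d3).fun_add (d5.fun_mul d4)),
      dZb_add (d1.fun_add d3) (d5.fun_mul d4),
      dZb_add d1 d3, dZb_mul d5 d4] at h
    linear_combination h
  have hlevi := conj_levi (z := z) ρ X
  rw [hX.2 X hX.1, map_zero] at hlevi
  have hT : ∑ l, X l * dZ n (cR n ρ) l z = 0 := hX.1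
  have hTb := sum_conj_mul_dZb_eq_zero hX.1
  have s1 : ∑ m, ∑ l, dZb n (normalFactor n ρ ψ) m z * dZ n (cR n ρ) l z
      * ((starRingEnd ℂ) (X m) * X l) = 0 := by
    refine Finset.sum_eq_zero fun m _ => ?_
    rw [← mul_zero (dZb n (normalFactor n ρ ψ) m z * (starRingEnd ℂ) (X m)), ← hT,
      Finset.mul_sum]
    exact Finset.sum_congr rfl fun l _ => by ring
  have s2 : ∑ m, ∑ l, normalFactor n ρ ψ z * dZb n (fun w => dZ n (cR n ρ) l w) m z
      * ((starRingEnd ℂ) (X m) * X l) = 0 := by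
    rw [← mul_zero (normalFactor n ρ ψ z), hlevi]
    simp only [Finset.mul_sum, mul_assoc]
  have s3 : ∑ m, ∑ l, b l * dZb n (cR n ρ) m z * ((starRingEnd ℂ) (X m) * X l) = 0 := by
    rw [Finset.sum_comm]
    refine Finset.sum_eq_zero fun l _ => ?_
    rw [← mul_zero (b l * X l), ← hTb, Finset.mul_sum]
    exact Finset.sum_congr rfl fun m _ => by ring
  simp only [hb', add_mul, Finset.sum_add_distrib, s1, s2, s3, add_zero, conj_levi]

theorem I_mul_dcEval_dAngelo (r : Pt n → ℝ) (X : Fin n → ℂ) :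
    Complex.I * dcEval (dAngelo n r) (X, 0) (0, conjVec X) z
      = ∑ m, ∑ l, dZb n (fun w => (dAngelo n r).w w l) m z * ((starRingEnd ℂ) (X m) * X l)
        + (starRingEnd ℂ) (∑ m, ∑ l, dZb n (fun w => (dAngelo n r).w w l) m z
          * ((starRingEnd ℂ) (X m) * X l)) := by
  simp only [dcEval, delEval, delbEval, dAngelo_t_eq_conj, dZ_conj, conjVec, Pi.zero_apply,
    map_sum, map_mul, Complex.conj_conj, mul_zero, zero_mul, sub_zero, zero_sub, mul_neg,
    Finset.sum_neg_distrib, Finset.sum_const_zero, zero_add, add_zero]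
  rw [← mul_assoc, Complex.I_mul_I]
  ring

theorem I_mul_dEval_dcForm (hψ : ContDiffAt ℝ (2 : ℕ) ψ z) (X : Fin n → ℂ) :
    Complex.I * dEval (dcForm n ψ) (X, 0) (0, conjVec X) z
      = -(levi n ψ z X X + (starRingEnd ℂ) (levi n ψ z X X)) := by
  have e1 : ∀ m l, dZ n (fun w => Complex.I * dZb n (cR n ψ) l w) m z
      = Complex.I * dZ n (fun w => dZb n (cR n ψ) l w) m z := by
    intro m l
    rw [dZ_mul (differentiableAt_const _)
      ((contDiffAt_dZb (m := 1) (contDiffAt_cR hψ) l).differentiableAt (by norm_num)), dZ_const]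
    ring
  have e2 : ∀ m l, dZb n (fun w => -Complex.I * dZ n (cR n ψ) l w) m z
      = -Complex.I * dZb n (fun w => dZ n (cR n ψ) l w) m z := by
    intro m l
    rw [dZb_mul (differentiableAt_const _)
      ((contDiffAt_dZ (m := 1) (contDiffAt_cR hψ) l).differentiableAt (by norm_num))]
    simp [dZb]
  rw [conj_levi, levi]
  simp only [dEval, delEval, delbEval, dcForm, conjVec, Pi.zero_apply, mul_zero, zero_mul,
    sub_zero, zero_sub, mul_neg, Finset.sum_neg_distrib, Finset.sum_const_zero, zero_add,
    add_zero, e1, e2, mul_assoc, ← Finset.mul_sum]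
  linear_combination (∑ m, ∑ l, dZ n (fun w => dZb n (cR n ψ) l w) m z
      * (X m * (starRingEnd ℂ) (X l)) + ∑ m, ∑ l, dZb n (fun w => dZ n (cR n ψ) l w) m z
      * ((starRingEnd ℂ) (X m) * X l)) * Complex.I_mul_I

theorem eval_dAngelo_mul_exp (heq : ∀ z, ρt z = ρ z * Real.exp (ψ z))
    (hρ : ContDiffAt ℝ (2 : ℕ) ρ z) (hρt : ContDiffAt ℝ (2 : ℕ) ρt z)
    (hψ : ContDiffAt ℝ (2 : ℕ) ψ z) (h0 : ρ z = 0) (hg : gradSq n ρ z ≠ 0)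
    {X : Fin n → ℂ} (hX : X ∈ T10 n ρ z) :
    Form1.eval (dAngelo n ρt) z (X, 0)
      = Form1.eval (dAngelo n ρ) z (X, 0) + ∑ j, X j * dZ n (cR n ψ) j z := by
  have hT : ∑ l, X l * dZ n (cR n ρ) l z = 0 := hX
  have h : ∑ j, normalFactor n ρ ψ z * dZ n (cR n ρ) j z * X j = 0 := by
    rw [← mul_zero (normalFactor n ρ ψ z), ← hT, Finset.mul_sum]
    exact Finset.sum_congr rfl fun l _ => by ring
  simp only [Form1.eval, dAngelo_w_mul_exp heq hρ hρt hψ h0 hg, add_mul, Finset.sum_add_distrib,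
    h, Pi.zero_apply, mul_zero, Finset.sum_const_zero, add_zero]
  simp only [mul_comm]

theorem eval_dAngelo_conjVec (r : Pt n → ℝ) (X : Fin n → ℂ) :
    Form1.eval (dAngelo n r) z (0, conjVec X)
      = (starRingEnd ℂ) (Form1.eval (dAngelo n r) z (X, 0)) := by
  simp [Form1.eval, conjVec, dAngelo_t_eq_conj]

end ChangeOfDefiningFunction

theorem IsDefining.eq_zero_of_mem_frontier {n : ℕ} {s : ℕ∞} {Ω V : Set (Pt n)} {ρ : Pt n → ℝ}
    (h : IsDefining n s Ω ρ V) (hΩ : IsOpen Ω) {p : Pt n} (hp : p ∈ frontier Ω) : ρ p = 0 := by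
  obtain ⟨hV, hcl, hC, hEq, -⟩ := h
  have hpV : p ∈ V := hcl (frontier_subset_closure hp)
  have hnot : p ∉ Ω := by
    rw [hΩ.frontier_eq] at hp
    exact hp.2
  have hge : 0 ≤ ρ p := by
    by_contra! hlt
    exact hnot (by rw [hEq]; exact ⟨hpV, hlt⟩)
  have hcont : ContinuousAt ρ p := (hC.contDiffAt (hV.mem_nhds hpV)).continuousAt
  refine le_antisymm ?_ hge
  by_contra! hpos
  obtain ⟨w, hw, hwΩ⟩ := mem_closure_iff_nhds.1 (frontier_subset_closure hp) _
    (hcont.eventually (lt_mem_nhds hpos))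
  rw [hEq] at hwΩ
  exact lt_asymm hw hwΩ.2

/-- Remark after Theorem 1.1 / Lemma 2.2 of [Yum2019]: behavior of the
D'Angelo 1-form under the change of defining function ρ̃ = ρ e^ψ:
(i) η_{ρ̃} = e^ψ η_ρ, T_{ρ̃} = e^{−ψ} T_ρ on ∂Ω; (ii) α̃(X) = α(X) + dψ(X) on
T^{1,0}(∂Ω) ⊕ T^{0,1}(∂Ω); (iii) i d^c α̃(L,L̄) = i d^c α(L,L̄) − i dd^c ψ(L,L̄) on Null_p. -/
theorem dAngelo_change_of_defining_function
    (n k : ℕ) (hn : 2 ≤ n) (hk : 3 ≤ k)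
    (Ω : Set (Pt n)) (hopen : IsOpen Ω) (hconn : IsConnected Ω)
    (hbdd : Bornology.IsBounded Ω)
    (ρ ρt : Pt n → ℝ) (ψ : Pt n → ℝ) (V Vt : Set (Pt n))
    (hdef : IsDefining n (k : ℕ∞) Ω ρ V)
    (hdeft : IsDefining n (k : ℕ∞) Ω ρt Vt)
    (hψ : ContDiffOn ℝ ((k - 1 : ℕ) : ℕ∞) ψ V)
    (heq : ∀ z, ρt z = ρ z * Real.exp (ψ z))
    (hpsc : ∀ r W, IsDefining n (k : ℕ∞) Ω r W → LeviPseudoconvex n r Ω) :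
    (∀ p ∈ frontier Ω,
      (∀ j, (etaF n ρt).w p j = (Real.exp (ψ p) : ℂ) * (etaF n ρ).w p j ∧
            (etaF n ρt).t p j = (Real.exp (ψ p) : ℂ) * (etaF n ρ).t p j) ∧
      (∀ j, (TVF n ρt).a p j = (Real.exp (-ψ p) : ℂ) * (TVF n ρ).a p j ∧
            (TVF n ρt).b p j = (Real.exp (-ψ p) : ℂ) * (TVF n ρ).b p j)) ∧
    (∀ p ∈ frontier Ω, ∀ X ∈ T10 n ρ p,
      (Form1.eval (dAngelo n ρt) p (X, 0)
        = Form1.eval (dAngelo n ρ) p (X, 0) + ∑ j, X j * dZ n (cR n ψ) j p) ∧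
      (Form1.eval (dAngelo n ρt) p (0, conjVec X)
        = Form1.eval (dAngelo n ρ) p (0, conjVec X)
            + ∑ j, (starRingEnd ℂ) (X j) * dZb n (cR n ψ) j p)) ∧
    (∀ p ∈ frontier Ω, ∀ L ∈ nullSp n ρ p,
      Complex.I * dcEval (dAngelo n ρt) (L, 0) (0, conjVec L) p
        = Complex.I * dcEval (dAngelo n ρ) (L, 0) (0, conjVec L) p
          - Complex.I * dEval (dcForm n ψ) (L, 0) (0, conjVec L) p) := by
  have base : ∀ p ∈ frontier Ω, ρ p = 0 ∧ ContDiffAt ℝ (3 : ℕ) ρ p ∧ ContDiffAt ℝ (3 : ℕ) ρt p ∧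
      ContDiffAt ℝ (2 : ℕ) ψ p ∧ fderiv ℝ ρ p ≠ 0 ∧ fderiv ℝ ρt p ≠ 0 := by
    intro p hp
    have hcl := frontier_subset_closure hp
    have hV := hdef.1.mem_nhds (hdef.2.1 hcl)
    have hVt := hdeft.1.mem_nhds (hdeft.2.1 hcl)
    refine ⟨hdef.eq_zero_of_mem_frontier hopen hp, (hdef.2.2.1.contDiffAt hV).of_le ?_,
      (hdeft.2.2.1.contDiffAt hVt).of_le ?_, (hψ.contDiffAt hV).of_le ?_,
      hdef.2.2.2.2 p hp, hdeft.2.2.2.2 p hp⟩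
    · exact WithTop.coe_le_coe.2 (Nat.cast_le.2 hk)
    · exact WithTop.coe_le_coe.2 (Nat.cast_le.2 hk)
    · have : 2 ≤ k - 1 := by omega
      exact WithTop.coe_le_coe.2 (Nat.cast_le.2 this)
  refine ⟨fun p hp => ?_, fun p hp X hX => ?_, fun p hp L hL => ?_⟩
  · obtain ⟨h0, hρ, -, hψ2, -, -⟩ := base p hp
    have dρ := hρ.differentiableAt (by norm_num)
    have dψ := hψ2.differentiableAt (by norm_num)
    have hz : cR n ρ p = 0 := by simp [cR, h0]
    have hE : (Real.exp (ψ p) : ℂ) = Complex.exp (cR n ψ p) := by simp [cR]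
    have hE' : (Real.exp (-ψ p) : ℂ) = (Complex.exp (cR n ψ p))⁻¹ := by
      simp [cR, Complex.exp_neg]
    have hne := Complex.exp_ne_zero (cR n ψ p)
    have hT : ∀ j, (TVF n ρt).a p j = (Real.exp (-ψ p) : ℂ) * (TVF n ρ).a p j := by
      intro j
      simp only [TVF, LnVF]
      rw [dZb_mul_exp heq dρ dψ, gradSq_mul_exp heq dρ dψ h0, hz, hE', zero_mul, add_zero,
        sq, mul_assoc, mul_div_mul_left _ _ hne, div_mul_eq_div_div_swap, div_eq_inv_mul]
    refine ⟨fun j => ⟨?_, ?_⟩, fun j => ⟨hT j, ?_⟩⟩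
    · simp only [etaF]
      rw [dZ_mul_exp heq dρ dψ, hz, hE]
      ring
    · simp only [etaF]
      rw [dZb_mul_exp heq dρ dψ, hz, hE]
      ring
    · change -(starRingEnd ℂ) ((TVF n ρt).a p j)
        = (Real.exp (-ψ p) : ℂ) * -(starRingEnd ℂ) ((TVF n ρ).a p j)
      rw [hT, map_mul, Complex.conj_ofReal, mul_neg]
  · obtain ⟨h0, hρ, hρt, hψ2, hd, -⟩ := base p hp
    have h := eval_dAngelo_mul_exp heq (hρ.of_le (by norm_cast)) (hρt.of_le (by norm_cast)) hψ2 h0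
      (gradSq_ne_zero (hρ.differentiableAt (by norm_num)) hd) hX
    refine ⟨h, ?_⟩
    rw [eval_dAngelo_conjVec, eval_dAngelo_conjVec, h, map_add, map_sum]
    simp only [map_mul, conj_dZ_cR]
  · obtain ⟨h0, hρ, hρt, hψ2, hd, hdt⟩ := base p hp
    rw [I_mul_dcEval_dAngelo, I_mul_dcEval_dAngelo, I_mul_dEval_dcForm hψ2,
      sum_dZb_dAngelo_w_mul_exp heq hρ hρt hψ2 h0 hd hdt hL, map_add, Complex.conj_conj]
    ring
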